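/- Let K be an inversive difference field of characteristic zero with basic set σ = {α₁,…,α_m} and let L = K⟨η₁,…,η_n⟩* be a σ*-field extension of K generated by the finite set η = {η₁,…,η_n}. Then there exists a polynomial φ_{η|K}(t) ∈ ℚ[t] such that: (i) φ_{η|K}(r) = trdeg_K K({γη_j : γ ∈ Γ(r), 1 ≤ j ≤ n}) for all sufficiently large r ∈ ℕ; (ii) deg φ_{η|K} ≤ m and φ_{η|K}(t) = Σ_{i=0}^{m} a_i C(t+i, i) with a₀,…,a_m ∈ ℤ and 2^m | a_m. -/

import Mathlib

/-- The univariate polynomial `t ↦ C(t + c, j)`. -/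
noncomputable def binomShift (c : ℤ) (j : ℕ) : Polynomial ℚ :=
  ((j.factorial : ℚ)⁻¹) • ((descPochhammer ℚ j).comp (Polynomial.X + Polynomial.C (c : ℚ)))

/-- The automorphism `γ = α₁^{k₁} ⋯ α_m^{k_m}` of `L` determined by the exponent vector `k`. -/
noncomputable def gammaPow {L : Type*} [Field L] {m : ℕ} (α : Fin m → RingAut L)
    (hc : ∀ i j, Commute (α i) (α j)) (k : Fin m → ℤ) : RingAut L :=
  Finset.univ.noncommProd (fun i => α i ^ k i)
    (fun i _ j _ _ => Commute.zpow_zpow (hc i j) (k i) (k j))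

/-- `ord γ = Σ_{i=1}^m |k_i|` for `γ = α₁^{k₁} ⋯ α_m^{k_m}`. -/
def ordTot {m : ℕ} (k : Fin m → ℤ) : ℕ := ∑ i, (k i).natAbs

/-- The transcendence degree over `K` of the field `K(S)` generated by `K` and `S ⊆ L`:
the maximal cardinality of a finite subset of `S` algebraically independent over `K`. -/
noncomputable def trdegGen {L : Type*} [Field L] (K : Subfield L) (S : Set L) : ℕ :=
  sSup {d : ℕ | ∃ T : Finset L, ↑T ⊆ S ∧ T.card = d ∧
    AlgebraicIndependent K (fun x : T => (x : L))}

/-- Functions eventually equal to a numerical polynomial, by backward differences. -/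
def NP : ℕ → ℤ → (ℕ → ℤ) → Prop
  | 0, a, f => ∃ r₀ : ℕ, ∀ r, r₀ ≤ r → f r = a
  | m + 1, a, f => NP m a (fun r => f r - f (r - 1))

theorem NP.congr {m : ℕ} : ∀ {a : ℤ} {f g : ℕ → ℤ}, NP m a f →
    (∃ r₀ : ℕ, ∀ r, r₀ ≤ r → f r = g r) → NP m a g := by
  induction m with
  | zero =>
    rintro a f g ⟨r₀, h⟩ ⟨r₁, h'⟩
    refine ⟨max r₀ r₁, fun r hr => ?_⟩
    rw [← h' r (by omega), h r (by omega)]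
  | succ m ih =>
    rintro a f g h ⟨r₁, h'⟩
    refine ih (a := a) h ⟨r₁ + 1, fun r hr => ?_⟩
    rw [h' r (by omega), h' (r - 1) (by omega)]

theorem NP.add {m : ℕ} : ∀ {a b : ℤ} {f g : ℕ → ℤ}, NP m a f → NP m b g →
    NP m (a + b) (fun r => f r + g r) := by
  induction m with
  | zero =>
    rintro a b f g ⟨r₀, h⟩ ⟨r₁, h'⟩
    refine ⟨max r₀ r₁, fun r hr => ?_⟩
    simp only
    rw [← h' r (by omega), h r (by omega)]
  | succ m ih =>
    intro a b f g h h'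
    refine (ih h h').congr ⟨0, fun r _ => ?_⟩
    simp only
    ring

theorem NP.smul {m : ℕ} (c : ℤ) : ∀ {a : ℤ} {f : ℕ → ℤ}, NP m a f →
    NP m (c * a) (fun r => c * f r) := by
  induction m with
  | zero =>
    rintro a f ⟨r₀, h⟩
    refine ⟨r₀, fun r hr => ?_⟩
    simp only
    rw [h r (by omega)]
  | succ m ih =>
    intro a f h
    refine (ih h).congr ⟨0, fun r _ => ?_⟩
    simp only
    ring

theorem NP.sub {m : ℕ} {a b : ℤ} {f g : ℕ → ℤ} (h : NP m a f) (h' : NP m b g) :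
    NP m (a - b) (fun r => f r - g r) := by
  have := h.add (h'.smul (-1))
  rw [show a + -1 * b = a - b by ring] at this
  exact this.congr ⟨0, fun r _ => by ring⟩

theorem NP.zero (m : ℕ) : NP m 0 (fun _ => 0) := by
  induction m with
  | zero => exact ⟨0, fun _ _ => rfl⟩
  | succ m ih => exact ih.congr ⟨0, fun r _ => by simp⟩

theorem NP.sum {m : ℕ} {ι : Type*} (s : Finset ι) (a : ι → ℤ) (f : ι → ℕ → ℤ)
    (h : ∀ i ∈ s, NP m (a i) (f i)) : NP m (∑ i ∈ s, a i) (fun r => ∑ i ∈ s, f i r) := by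
  classical
  induction s using Finset.induction_on with
  | empty => simpa using NP.zero m
  | insert i s hi ih =>
    rw [Finset.sum_insert hi]
    refine ((h i (by simp)).add (ih fun j hj => h j (by simp [hj]))).congr ⟨0, fun r _ => ?_⟩
    rw [Finset.sum_insert hi]

theorem NP.lift {m : ℕ} : ∀ {a : ℤ} {f : ℕ → ℤ}, NP m a f → NP (m + 1) 0 f := by
  induction m with
  | zero =>
    rintro a f ⟨r₀, h⟩
    refine ⟨r₀ + 1, fun r hr => ?_⟩
    simp only
    rw [h r (by omega), h (r - 1) (by omega)]; ring
  | succ m ih =>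
    intro a f h
    exact ih (a := a) h

theorem NP.shift {m : ℕ} : ∀ {a : ℤ} {f : ℕ → ℤ}, NP m a f → NP m a (fun r => f (r - 1)) := by
  induction m with
  | zero =>
    rintro a f ⟨r₀, h⟩
    refine ⟨r₀ + 1, fun r hr => ?_⟩
    simp only
    rw [h (r - 1) (by omega)]
  | succ m ih =>
    intro a f h
    exact ih (a := a) h

theorem NP.cum {m : ℕ} {a : ℤ} {f : ℕ → ℤ} (h : NP m a f) :
    NP (m + 1) a (fun r => ∑ k ∈ Finset.range (r + 1), f (r - k)) := by
  refine NP.congr (m := m) h ⟨1, fun r hr => ?_⟩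
  obtain ⟨r, rfl⟩ : ∃ s, r = s + 1 := ⟨r - 1, by omega⟩
  simp only [Nat.add_sub_cancel]
  rw [Finset.sum_range_succ' _ (r + 1)]
  simp

theorem NP.conv {m : ℕ} {a : ℤ} {g : ℕ → ℤ} (hg : NP m a g) (N : ℕ) :
    ∀ (F : ℕ → ℕ → ℤ), (∀ k, ∃ b, NP m b (F k)) → (∀ k, N ≤ k → F k = g) →
    NP (m + 1) a (fun r => ∑ k ∈ Finset.range (r + 1), F k (r - k)) := by
  induction N with
  | zero =>
    intro F _ hF
    refine hg.cum.congr ⟨0, fun r _ => ?_⟩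
    simp [hF]
  | succ N ih =>
    intro F hN hF
    obtain ⟨b, hb⟩ := hN 0
    have h1 := ih (fun k => F (k + 1)) (fun k => hN (k + 1)) (fun k hk => hF _ (by omega))
    have h2 := hb.lift.add h1.shift
    rw [zero_add] at h2
    refine h2.congr ⟨1, fun r hr => ?_⟩
    obtain ⟨r, rfl⟩ : ∃ s, r = s + 1 := ⟨r - 1, by omega⟩
    simp only [Nat.add_sub_cancel]
    rw [Finset.sum_range_succ' _ (r + 1)]
    simp [add_comm]

theorem NP.neg {m : ℕ} : ∀ {a : ℤ} {f : ℕ → ℤ}, NP m a f → a < 0 →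
    ∃ r₀ : ℕ, ∀ r, r₀ ≤ r → f r < 0 := by
  induction m with
  | zero =>
    rintro a f ⟨r₀, h⟩ ha
    exact ⟨r₀, fun r hr => by rw [h r hr]; exact ha⟩
  | succ m ih =>
    intro a f h ha
    obtain ⟨r₀, hr⟩ := ih (a := a) h ha
    have key : ∀ k : ℕ, f (r₀ + k) ≤ f r₀ - k := by
      intro k
      induction k with
      | zero => simp
      | succ k ihk =>
        have := hr (r₀ + k + 1) (by omega)
        simp only [Nat.add_sub_cancel] at this
        rw [← add_assoc]
        push_cast
        omega
    refine ⟨r₀ + (f r₀).natAbs + 1, fun r hr => ?_⟩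
    have := key (r - r₀)
    rw [show r₀ + (r - r₀) = r by omega] at this
    omega

theorem NP.le {m : ℕ} {a b : ℤ} {f g : ℕ → ℤ} (h : NP m a f) (h' : NP m b g)
    (hfg : ∀ r, f r ≤ g r) : a ≤ b := by
  by_contra hlt
  obtain ⟨r₀, hr⟩ := (h'.sub h).neg (by omega)
  have := hr r₀ le_rfl
  have := hfg r₀
  omega

theorem NP.binom {m : ℕ} : ∀ {a : ℤ} {f : ℕ → ℤ}, NP m a f →
    ∃ c : ℕ → ℤ, c m = a ∧ ∃ r₀ : ℕ, ∀ r, r₀ ≤ r →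
      f r = ∑ i ∈ Finset.range (m + 1), c i * ((r + i).choose i : ℤ) := by
  induction m with
  | zero =>
    rintro a f ⟨r₀, h⟩
    refine ⟨fun _ => a, rfl, r₀, fun r hr => ?_⟩
    simp [h r hr]
  | succ m ih =>
    intro a f h
    obtain ⟨c, hc, r₀, hr⟩ := ih (a := a) h
    set S : ℕ → ℤ := fun r => ∑ i ∈ Finset.range (m + 1), c i * ((r + (i + 1)).choose (i + 1) : ℤ)
      with hS
    have hdiff : ∀ r, S (r + 1) - S r =
        ∑ i ∈ Finset.range (m + 1), c i * ((r + 1 + i).choose i : ℤ) := by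
      intro r
      rw [hS, ← Finset.sum_sub_distrib]
      refine Finset.sum_congr rfl fun i _ => ?_
      rw [show r + 1 + (i + 1) = (r + 1 + i) + 1 by ring, Nat.choose_succ_succ,
        show r + (i + 1) = r + 1 + i by ring]
      push_cast
      ring
    have key : ∀ k : ℕ, f (r₀ + k) - S (r₀ + k) = f r₀ - S r₀ := by
      intro k
      induction k with
      | zero => simp
      | succ k ihk =>
        have h1 := hr (r₀ + k + 1) (by omega)
        have h2 := hdiff (r₀ + k)
        simp only [Nat.add_sub_cancel] at h1
        rw [← add_assoc]
        linarith
    refine ⟨fun i => Nat.casesOn i (f r₀ - S r₀) c, hc, r₀, fun r hr => ?_⟩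
    have := key (r - r₀)
    rw [show r₀ + (r - r₀) = r by omega] at this
    rw [Finset.sum_range_succ']
    simp only [Nat.choose_zero_right]
    rw [← this]
    simp [hS]

/-- `u` lies in the box between the origin and `v`. -/
def leZ {m : ℕ} (u v : Fin m → ℤ) : Prop :=
  ∀ i, (u i).toNat ≤ (v i).toNat ∧ (-(u i)).toNat ≤ (-(v i)).toNat

/-- Sets closed under going towards the origin. -/
def DownC {m : ℕ} (W : Set (Fin m → ℤ)) : Prop := ∀ u v, leZ u v → v ∈ W → u ∈ W

theorem DownC.stab {m : ℕ} (D : ℕ → Set (Fin m → ℤ)) (hD : ∀ k, DownC (D k))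
    (ha : Antitone D) : ∃ N, ∀ k, N ≤ k → D k = D N := by
  by_contra hcon
  push Not at hcon
  have h1 : ∀ N, ∃ k, N ≤ k ∧ ∃ x, x ∈ D N ∧ x ∉ D k := by
    intro N
    obtain ⟨k, hk, hne⟩ := hcon N
    refine ⟨k, hk, ?_⟩
    by_contra hno
    push Not at hno
    exact hne (Set.Subset.antisymm (ha hk) hno)
  choose k hk x hx hx' using h1
  let seq : ℕ → ℕ := fun j => k^[j] 0
  have hmono : Monotone seq := by
    refine monotone_nat_of_le_succ fun j => ?_
    simp only [seq, Function.iterate_succ_apply']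
    exact hk _
  let g : ℕ → (Fin m → ℕ × ℕ) := fun j i =>
    ((x (seq j) i).toNat, (-(x (seq j) i)).toNat)
  obtain ⟨i, j, hij, hle⟩ := (wellQuasiOrdered_le (α := Fin m → ℕ × ℕ)) g
  have h2 : x (seq i) ∈ D (seq j) :=
    hD _ (x (seq i)) (x (seq j)) (fun t => ⟨(hle t).1, (hle t).2⟩) (hx (seq j))
  have h3 : k (seq i) ≤ seq j := by
    have := hmono (show i + 1 ≤ j from hij)
    simpa only [seq, Function.iterate_succ_apply'] using this
  exact hx' (seq i) (ha h3 h2)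

theorem ordTot_finite (m r : ℕ) : {v : Fin m → ℤ | ordTot v ≤ r}.Finite := by
  refine (Set.finite_Icc (fun _ : Fin m => -(r : ℤ)) (fun _ => (r : ℤ))).subset ?_
  intro v hv
  have h : ∀ i, (v i).natAbs ≤ r := fun i =>
    (Finset.single_le_sum (f := fun i => (v i).natAbs) (fun _ _ => Nat.zero_le _)
      (Finset.mem_univ i)).trans hv
  refine ⟨fun i => ?_, fun i => ?_⟩ <;> have := h i <;> simp only <;> omega

/-- Number of points of `W` of order at most `r`. -/
noncomputable def cnt {m : ℕ} (W : Set (Fin m → ℤ)) (r : ℕ) : ℕ :=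
  {v : Fin m → ℤ | v ∈ W ∧ ordTot v ≤ r}.ncard

/-- Slice at first coordinate. -/
def slice {m : ℕ} (W : Set (Fin (m + 1) → ℤ)) (k : ℤ) : Set (Fin m → ℤ) :=
  {v | (Fin.cons k v : Fin (m + 1) → ℤ) ∈ W}

theorem ordTot_cons {m : ℕ} (k : ℤ) (v : Fin m → ℤ) :
    ordTot (Fin.cons k v : Fin (m + 1) → ℤ) = k.natAbs + ordTot v := by
  simp [ordTot, Fin.sum_univ_succ]

theorem leZ_cons {m : ℕ} {k l : ℤ} {u v : Fin m → ℤ}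
    (hk : k.toNat ≤ l.toNat ∧ (-k).toNat ≤ (-l).toNat) (h : leZ u v) :
    leZ (Fin.cons k u : Fin (m + 1) → ℤ) (Fin.cons l v) := by
  intro i
  refine Fin.cases ?_ (fun i => ?_) i
  · simpa using hk
  · simpa using h i

theorem leZ_refl {m : ℕ} (u : Fin m → ℤ) : leZ u u := fun _ => ⟨le_rfl, le_rfl⟩

theorem slice_downC {m : ℕ} {W : Set (Fin (m + 1) → ℤ)} (hW : DownC W) (k : ℤ) :
    DownC (slice W k) := fun _ _ h hv => hW _ _ (leZ_cons ⟨le_rfl, le_rfl⟩ h) hv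

theorem cnt_fiber {m : ℕ} (W : Set (Fin (m + 1) → ℤ)) (r : ℕ) (k : ℤ) (hk : k.natAbs ≤ r) :
    {v : Fin (m + 1) → ℤ | (v ∈ W ∧ ordTot v ≤ r) ∧ v 0 = k}.ncard =
      cnt (slice W k) (r - k.natAbs) := by
  unfold cnt
  rw [← Set.ncard_image_of_injective {v : Fin m → ℤ | v ∈ slice W k ∧ ordTot v ≤ r - k.natAbs}
    (Fin.cons_right_injective (α := fun _ => ℤ) k)]
  refine congrArg Set.ncard ?_
  ext v
  constructor
  · rintro ⟨⟨h1, h2⟩, h3⟩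
    have hv : v = Fin.cons k (Fin.tail v) := by rw [← h3, Fin.cons_self_tail]
    refine ⟨Fin.tail v, ⟨?_, ?_⟩, hv.symm⟩
    · show Fin.cons k (Fin.tail v) ∈ W
      rwa [← hv]
    · rw [hv, ordTot_cons] at h2
      omega
  · rintro ⟨u, ⟨h1, h2⟩, rfl⟩
    refine ⟨⟨h1, ?_⟩, by simp⟩
    rw [ordTot_cons]
    omega

theorem sum_Icc_symm (h : ℤ → ℤ) (r : ℕ) : ∑ k ∈ Finset.Icc (-(r : ℤ)) r, h k =
    (∑ k ∈ Finset.range (r + 1), h k + ∑ k ∈ Finset.range (r + 1), h (-(k : ℤ))) - h 0 := by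
  induction r with
  | zero => simp
  | succ r ih =>
    have : Finset.Icc (-((r + 1 : ℕ) : ℤ)) ((r + 1 : ℕ) : ℤ) =
        insert (-((r + 1 : ℕ) : ℤ)) (insert ((r + 1 : ℕ) : ℤ) (Finset.Icc (-(r : ℤ)) r)) := by
      ext x
      simp only [Finset.mem_Icc, Finset.mem_insert]
      omega
    rw [this, Finset.sum_insert, Finset.sum_insert, ih, Finset.sum_range_succ _ (r + 1),
      Finset.sum_range_succ (fun k => h (-((k : ℕ) : ℤ))) (r + 1)]
    · ring
    · simp
    · simp only [Finset.mem_Icc, Finset.mem_insert]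
      omega

theorem cnt_succ {m : ℕ} (W : Set (Fin (m + 1) → ℤ)) (r : ℕ) : (cnt W r : ℤ) =
    (∑ k ∈ Finset.range (r + 1), (cnt (slice W k) (r - k) : ℤ) +
      ∑ k ∈ Finset.range (r + 1), (cnt (slice W (-(k : ℤ))) (r - k) : ℤ)) -
      cnt (slice W 0) r := by
  classical
  have hfin : {v : Fin (m + 1) → ℤ | v ∈ W ∧ ordTot v ≤ r}.Finite :=
    (ordTot_finite _ r).subset fun v hv => hv.2
  have h1 : cnt W r = ∑ k ∈ Finset.Icc (-(r : ℤ)) r, cnt (slice W k) (r - k.natAbs) := by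
    unfold cnt
    rw [Set.ncard_eq_toFinset_card _ hfin,
      Finset.card_eq_sum_card_fiberwise (f := fun v => v 0) (t := Finset.Icc (-(r : ℤ)) r)]
    · refine Finset.sum_congr rfl fun k hk => ?_
      have := cnt_fiber W r k (by rw [Finset.mem_Icc] at hk; omega)
      unfold cnt at this
      rw [← this, ← Set.ncard_coe_finset]
      congr 1
      ext v
      simp
    · intro v hv
      have hv' : ordTot v ≤ r := by
        have := hv
        simp at this
        exact this.2
      have : (v 0).natAbs ≤ r :=
        (Finset.single_le_sum (f := fun i => (v i).natAbs) (fun _ _ => Nat.zero_le _)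
          (Finset.mem_univ 0)).trans hv'
      simp only [Finset.coe_Icc, Set.mem_Icc]
      omega
  rw [h1]
  push_cast
  rw [sum_Icc_symm (fun k => (cnt (slice W k) (r - k.natAbs) : ℤ))]
  simp

/-- Closed orthants. -/
def orth {m : ℕ} (s : Fin m → Bool) : Set (Fin m → ℤ) :=
  {v | ∀ i, if s i = true then 0 ≤ v i else v i ≤ 0}

open Classical in
/-- Number of orthants contained in `W`. -/
noncomputable def lead {m : ℕ} (W : Set (Fin m → ℤ)) : ℕ :=
  (Finset.univ.filter fun s : Fin m → Bool => orth s ⊆ W).card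

theorem orth_cons {m : ℕ} (W : Set (Fin (m + 1) → ℤ)) (b : Bool) (s : Fin m → Bool) :
    orth (Fin.cons b s : Fin (m + 1) → Bool) ⊆ W ↔
      orth s ⊆ ⋂ k : ℕ, slice W (if b = true then (k : ℤ) else -(k : ℤ)) := by
  constructor
  · intro h v hv
    rw [Set.mem_iInter]
    intro k
    refine h fun i => ?_
    refine Fin.cases ?_ (fun i => ?_) i
    · cases b <;> simp
    · simpa using hv i
  · intro h v hv
    have h0 := hv 0
    have ht : Fin.tail v ∈ orth s := fun i => by simpa [Fin.tail] using hv i.succ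
    have := Set.mem_iInter.1 (h ht) (v 0).natAbs
    have h2 : (if b = true then ((v 0).natAbs : ℤ) else -((v 0).natAbs : ℤ)) = v 0 := by
      cases b with
      | false =>
        have h5 : v 0 ≤ 0 := by simpa using h0
        simp only [Bool.false_eq_true, if_false]
        omega
      | true =>
        have h5 : 0 ≤ v 0 := by simpa using h0
        simp only [if_true]
        omega
    rw [h2] at this
    have h3 : (Fin.cons (v 0) (Fin.tail v) : Fin (m + 1) → ℤ) ∈ W := this
    rwa [Fin.cons_self_tail] at h3

theorem lead_succ {m : ℕ} (W : Set (Fin (m + 1) → ℤ)) :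
    lead W = lead (⋂ k : ℕ, slice W (k : ℤ)) + lead (⋂ k : ℕ, slice W (-(k : ℤ))) := by
  classical
  unfold lead
  simp only [Finset.card_filter]
  rw [← (Fin.consEquiv (fun _ => Bool)).sum_comp, Fintype.sum_prod_type]
  simp only [Fintype.sum_bool]
  congr 1
  · refine Finset.sum_congr rfl fun s _ => ?_
    exact if_congr ((orth_cons W true s).trans (by simp)) rfl rfl
  · refine Finset.sum_congr rfl fun s _ => ?_
    exact if_congr ((orth_cons W false s).trans (by simp)) rfl rfl

theorem cnt_NP {m : ℕ} : ∀ W : Set (Fin m → ℤ), DownC W →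
    NP m (lead W) (fun r => (cnt W r : ℤ)) := by
  induction m with
  | zero =>
    intro W _
    refine ⟨0, fun r _ => ?_⟩
    classical
    unfold cnt lead
    by_cases h : (fun i => Fin.elim0 i : Fin 0 → ℤ) ∈ W
    · have hW : W = Set.univ := by
        ext v; simp [Subsingleton.elim v (fun i => Fin.elim0 i), h]
      subst hW
      have : {v : Fin 0 → ℤ | v ∈ Set.univ ∧ ordTot v ≤ r} = {fun i => Fin.elim0 i} := by
        ext v; simp [ordTot, Subsingleton.elim v (fun i => Fin.elim0 i)]
      simp only [this]
      simp
    · have hW : W = ∅ := by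
        ext v; simp [Subsingleton.elim v (fun i => Fin.elim0 i), h]
      subst hW
      have h2 : ∀ s : Fin 0 → Bool, ¬ orth s ⊆ ∅ := by
        intro s hs
        exact hs (show (fun i => Fin.elim0 i : Fin 0 → ℤ) ∈ orth s from fun i => Fin.elim0 i)
      simp [h2]
  | succ m ih =>
    intro W hW
    have main : ∀ ε : ℤ, (ε = 1 ∨ ε = -1) →
        NP (m + 1) (lead (⋂ k : ℕ, slice W (ε * (k : ℤ))))
          (fun r => ∑ k ∈ Finset.range (r + 1), (cnt (slice W (ε * k)) (r - k) : ℤ)) := by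
      intro ε hε
      have hanti : Antitone fun k : ℕ => slice W (ε * (k : ℤ)) := by
        intro a b hab v hv
        refine hW _ _ (leZ_cons ?_ (leZ_refl v)) hv
        rcases hε with rfl | rfl <;> constructor <;> omega
      obtain ⟨N, hN⟩ := DownC.stab (fun k : ℕ => slice W (ε * (k : ℤ)))
        (fun k => slice_downC hW _) hanti
      have hI : (⋂ k : ℕ, slice W (ε * (k : ℤ))) = slice W (ε * (N : ℤ)) := by
        apply Set.Subset.antisymm (Set.iInter_subset _ N)
        refine Set.subset_iInter fun k => ?_
        rcases le_total k N with h | h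
        · exact hanti h
        · exact (hN k h).ge
      rw [hI]
      refine NP.conv (ih _ (slice_downC hW _)) N (fun k r => (cnt (slice W (ε * k)) r : ℤ))
        (fun k => ⟨_, ih _ (slice_downC hW _)⟩) (fun k hk => ?_)
      have := hN k hk
      rw [this]
    have h1 := main 1 (Or.inl rfl)
    have h2 := main (-1) (Or.inr rfl)
    have h3 := ((h1.add h2).sub (ih _ (slice_downC hW 0)).lift)
    rw [lead_succ]
    simp only [one_mul, neg_one_mul] at h3
    push_cast
    rw [sub_zero] at h3
    exact h3.congr ⟨0, fun r _ => (cnt_succ W r).symm⟩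

section greedy

variable {L : Type*} [Field L] {K : Subfield L} {ι Λ : Type*} [LinearOrder Λ]

theorem alg_trans {s t : Set L} (h : ∀ x ∈ s, IsAlgebraic (Algebra.adjoin K t) x) {a : L}
    (ha : IsAlgebraic (Algebra.adjoin K s) a) : IsAlgebraic (Algebra.adjoin K t) a :=
  IsAlgebraic.adjoin_of_forall_isAlgebraic (fun x hx => h x hx.1) ha

theorem alg_self {t : Set L} {x : L} (hx : x ∈ t) : IsAlgebraic (Algebra.adjoin K t) x :=
  isAlgebraic_algebraMap (⟨x, Algebra.subset_adjoin hx⟩ : Algebra.adjoin K t)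

theorem alg_mono {s t : Set L} (h : s ⊆ t) {a : L}
    (ha : IsAlgebraic (Algebra.adjoin K s) a) : IsAlgebraic (Algebra.adjoin K t) a :=
  alg_trans (fun _ hx => alg_self (h hx)) ha

theorem alg_map (g : L ≃+* L) (hg : ∀ x ∈ K, g x ∈ K) {s : Set L} {a : L}
    (ha : IsAlgebraic (Algebra.adjoin K s) a) : IsAlgebraic (Algebra.adjoin K (g '' s)) (g a) := by
  have hmem : ∀ x ∈ Algebra.adjoin K s, (g : L →+* L) x ∈ Algebra.adjoin K (g '' s) := by
    intro x hx
    induction hx using Algebra.adjoin_induction with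
    | mem x hx => exact Algebra.subset_adjoin ⟨x, hx, rfl⟩
    | algebraMap r =>
      exact (Algebra.adjoin K (g '' s)).algebraMap_mem ⟨g r, hg r r.2⟩
    | add x y _ _ hx hy => rw [map_add]; exact add_mem hx hy
    | mul x y _ _ hx hy => rw [map_mul]; exact mul_mem hx hy
  refine IsAlgebraic.ringHom_of_comp_eq
    ((g : L →+* L).restrict (Algebra.adjoin K s) (Algebra.adjoin K (g '' s)) hmem) (g : L →+* L)
    ha ?_ ?_
  · intro x y hxy
    have := congrArg Subtype.val hxy
    exact Subtype.ext (g.injective this)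
  · ext x
    rfl

variable (K) in
/-- Greedy independent set. -/
def greedy (κ : ι → Λ) (x : ι → L) : Set ι :=
  {t | Transcendental (Algebra.adjoin K (x '' {u | κ u < κ t})) (x t)}

theorem greedy_indep (κ : ι → Λ) (hκ : Function.Injective κ) (x : ι → L) :
    AlgebraicIndepOn K x (greedy K κ x) := by
  classical
  have fin : ∀ F : Finset ι, (↑F ⊆ greedy K κ x) → AlgebraicIndepOn K x (F : Set ι) := by
    intro F
    induction F using Finset.induction_on_max_value κ with
    | empty =>
      intro _
      have : IsEmpty ((∅ : Finset ι) : Set ι) := by simp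
      exact algebraicIndependent_empty_type
    | insert a s has hmax ih =>
      intro hs
      rw [Finset.coe_insert] at hs ⊢
      rw [AlgebraicIndepOn.insert_iff (by simpa using has)]
      refine ⟨ih ((Set.subset_insert _ _).trans hs), fun halg => ?_⟩
      refine hs (Set.mem_insert _ _) (alg_mono (Set.image_mono ?_) halg)
      intro u hu
      refine lt_of_le_of_ne (hmax u hu) fun h => has ?_
      rw [← hκ h]
      exact hu
  refine algebraicIndependent_of_finite_type fun t ht => ?_
  have h1 := fin ((ht.image Subtype.val).toFinset) (by
    intro u hu
    simp at hu
    exact hu.1)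
  have h2 := h1.comp (fun i : t => ⟨i.1.1, by simp⟩) (by
    intro i j hij
    simp only [Subtype.mk.injEq] at hij
    exact Subtype.ext (Subtype.ext hij))
  exact h2

theorem greedy_span [WellFoundedLT Λ] (κ : ι → Λ) (x : ι → L) (t : ι) :
    IsAlgebraic (Algebra.adjoin K (x '' {u | u ∈ greedy K κ x ∧ κ u ≤ κ t})) (x t) := by
  have wf : WellFounded fun a b : ι => κ a < κ b := InvImage.wf κ wellFounded_lt
  induction t using wf.induction with
  | _ t ih =>
    by_cases h : t ∈ greedy K κ x
    · exact alg_self ⟨t, ⟨h, le_rfl⟩, rfl⟩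
    · have h' : IsAlgebraic (Algebra.adjoin K (x '' {u | κ u < κ t})) (x t) := by
        by_contra hn
        exact h hn
      refine alg_trans ?_ h'
      rintro _ ⟨u, hu, rfl⟩
      have hsub : {v | v ∈ greedy K κ x ∧ κ v ≤ κ u} ⊆ {v | v ∈ greedy K κ x ∧ κ v ≤ κ t} :=
        fun v hv => ⟨hv.1, hv.2.trans (le_of_lt hu)⟩
      exact alg_mono (Set.image_mono hsub) (ih u hu)

theorem trdegGen_eq [WellFoundedLT Λ] (κ : ι → Λ) (hκ : Function.Injective κ) (x : ι → L)
    (T : Set ι) (hT : T.Finite) (hdown : ∀ t ∈ T, ∀ u, κ u ≤ κ t → u ∈ T) :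
    trdegGen K (x '' T) = (greedy K κ x ∩ T).ncard := by
  classical
  have hind := (greedy_indep (K := K) κ hκ x).mono (Set.inter_subset_left (t := T))
  have hinj : Set.InjOn x (greedy K κ x ∩ T) := by
    intro a ha b hb hab
    have := hind.injective (a₁ := ⟨a, ha⟩) (a₂ := ⟨b, hb⟩) hab
    exact congrArg Subtype.val this
  set B : Set L := x '' (greedy K κ x ∩ T) with hB
  have hBfin : B.Finite := (hT.subset Set.inter_subset_right).image x
  have hBind : AlgebraicIndependent K (fun y : B => (y : L)) := hind.image
  let M := AlgebraicIndependent.matroid K L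
  have hbasis : M.IsBasis B (x '' T) := by
    refine Matroid.Indep.isBasis_of_subset_of_subset_closure (M := M) hBind
      (Set.image_mono Set.inter_subset_right) ?_
    rintro _ ⟨t, ht, rfl⟩
    rw [AlgebraicIndependent.matroid_closure_eq]
    have hsub : {v | v ∈ greedy K κ x ∧ κ v ≤ κ t} ⊆ greedy K κ x ∩ T :=
      fun u hu => ⟨hu.1, hdown t ht u hu.2⟩
    exact alg_mono (Set.image_mono hsub) (greedy_span κ x t)
  rw [← hinj.ncard_image]
  unfold trdegGen
  refine IsGreatest.csSup_eq ⟨⟨hBfin.toFinset, ?_, ?_, ?_⟩, ?_⟩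
  · simp only [Set.Finite.coe_toFinset]
    exact Set.image_mono Set.inter_subset_right
  · exact (Set.ncard_eq_toFinset_card B hBfin).symm
  · have := hBind.comp (fun y : hBfin.toFinset => (⟨y.1, hBfin.mem_toFinset.1 y.2⟩ : B)) (by
      intro a b hab
      simp only [Subtype.mk.injEq] at hab
      exact Subtype.ext hab)
    exact this
  · rintro d ⟨F, hF, rfl, hFi⟩
    have h1 : (F : Set L).encard ≤ M.eRk (x '' T) :=
      Matroid.Indep.encard_le_eRk_of_subset (M := M) hFi hF
    rw [← hbasis.encard_eq_eRk, ← hBfin.cast_ncard_eq, Set.encard_coe_eq_coe_finsetCard] at h1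
    exact_mod_cast h1

end greedy

theorem gammaPow_add {L : Type*} [Field L] {m : ℕ} (α : Fin m → RingAut L)
    (hc : ∀ i j, Commute (α i) (α j)) (k l : Fin m → ℤ) :
    gammaPow α hc (k + l) = gammaPow α hc k * gammaPow α hc l := by
  unfold gammaPow
  refine Eq.trans ?_ (Finset.noncommProd_mul_distrib (fun i => α i ^ k i) (fun i => α i ^ l i)
    (fun i _ j _ _ => Commute.zpow_zpow (hc i j) (k i) (k j))
    (fun i _ j _ _ => Commute.zpow_zpow (hc i j) (l i) (l j)) ?_)
  · refine Finset.noncommProd_congr rfl (fun i _ => ?_) _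
    simp [zpow_add]
  · intro i _ j _ _
    exact Commute.zpow_zpow (hc i j) _ _

theorem gammaPow_mem {L : Type*} [Field L] (K : Subfield L) {m : ℕ} (α : Fin m → RingAut L)
    (hc : ∀ i j, Commute (α i) (α j)) (hK : ∀ i, K.map ↑(α i) = K) (k : Fin m → ℤ)
    (x : L) : gammaPow α hc k x ∈ K ↔ x ∈ K := by
  let H : Subgroup (RingAut L) :=
    { carrier := {g | ∀ x, g x ∈ K ↔ x ∈ K}
      mul_mem' := fun {a b} ha hb x => by
        rw [RingAut.mul_apply]
        exact (ha _).trans (hb _)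
      one_mem' := fun x => Iff.rfl
      inv_mem' := fun {a} ha x => by
        rw [← ha (a⁻¹ x), ← RingAut.mul_apply, mul_inv_cancel, RingAut.one_apply] }
  have hα : ∀ i, α i ∈ H := by
    intro i x
    constructor
    · intro h
      rw [← hK i] at h
      obtain ⟨y, hy, hyx⟩ := h
      have : y = x := (α i).injective hyx
      exact this ▸ hy
    · intro h
      rw [← hK i]
      exact ⟨x, h, rfl⟩
  have : gammaPow α hc k ∈ H :=
    Subgroup.noncommProd_mem H _ fun i _ => H.zpow_mem (hα i) _
  exact this x

/-- Enumeration `0, -1, 1, -2, 2, …` of the integers. -/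
def ez (z : ℤ) : ℕ := if 0 ≤ z then 2 * z.natAbs else 2 * z.natAbs - 1

theorem ez_inj : Function.Injective ez := by
  intro a b h
  unfold ez at h
  split_ifs at h <;> omega

theorem ez_shift {u g g' : ℤ} (h : g.toNat ≤ g'.toNat ∧ (-g).toNat ≤ (-g').toNat)
    (hu : ez u < ez g) : ez (u + (g' - g)) < ez g' := by
  unfold ez at *
  split_ifs at * <;> omega

theorem ord_shift {u g g' : ℤ} (h : g.toNat ≤ g'.toNat ∧ (-g).toNat ≤ (-g').toNat) :
    (u + (g' - g)).natAbs + g.natAbs ≤ u.natAbs + g'.natAbs := by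
  omega

/-- Ranking key for the terms `γ η_j`. -/
def key {m n : ℕ} (t : (Fin m → ℤ) × Fin n) : ℕ ×ₗ (Lex (Fin m → ℕ) ×ₗ Fin n) :=
  toLex (ordTot t.1, toLex (toLex (fun i => ez (t.1 i)), t.2))

theorem key_inj {m n : ℕ} : Function.Injective (key (m := m) (n := n)) := by
  rintro ⟨a, i⟩ ⟨b, j⟩ h
  have h1 := toLex.injective h
  rw [Prod.mk.injEq] at h1
  have h2 := toLex.injective h1.2
  rw [Prod.mk.injEq] at h2
  have h3 := toLex.injective h2.1
  refine Prod.ext ?_ h2.2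
  funext k
  exact ez_inj (congrFun h3 k)

theorem key_shift {m n : ℕ} {u g g' : Fin m → ℤ} {l j : Fin n} (h : leZ g g')
    (hlt : key (u, l) < key (g, j)) : key (u + (g' - g), l) < key (g', j) := by
  have hord : ordTot (u + (g' - g)) + ordTot g ≤ ordTot u + ordTot g' := by
    unfold ordTot
    rw [← Finset.sum_add_distrib, ← Finset.sum_add_distrib]
    exact Finset.sum_le_sum fun i _ => ord_shift (h i)
  unfold key at *
  rw [Prod.Lex.toLex_lt_toLex] at *
  simp only at hlt ⊢
  rcases hlt with hlt | ⟨heq, hlt⟩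
  · left; omega
  · rcases lt_or_eq_of_le (show ordTot (u + (g' - g)) ≤ ordTot g' by omega) with h1 | h1
    · exact Or.inl h1
    · refine Or.inr ⟨h1, ?_⟩
      rw [Prod.Lex.toLex_lt_toLex] at *
      simp only at hlt ⊢
      rcases hlt with ⟨i, hi, hlt⟩ | ⟨heq, hlt⟩
      · left
        refine ⟨i, fun k hk => ?_, ez_shift (h i) hlt⟩
        have h2 : u k = g k := ez_inj (hi k hk)
        show ez (u k + (g' k - g k)) = ez (g' k)
        rw [h2]
        congr 1
        ring
      · right
        have h2 : u = g := by
          funext k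
          exact ez_inj (congrFun (toLex.injective heq) k)
        subst h2
        refine ⟨?_, hlt⟩
        congr 2
        funext k
        congr 1
        simp

theorem key_ord {m n : ℕ} {s t : (Fin m → ℤ) × Fin n} (h : key s ≤ key t) :
    ordTot s.1 ≤ ordTot t.1 := by
  unfold key at h
  rw [Prod.Lex.toLex_le_toLex] at h
  rcases h with h | h
  · exact le_of_lt h
  · exact le_of_eq h.1

theorem terms_finite (m n r : ℕ) : {t : (Fin m → ℤ) × Fin n | ordTot t.1 ≤ r}.Finite := by
  refine ((ordTot_finite m r).prod (Set.finite_univ (α := Fin n))).subset ?_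
  intro t ht
  exact ⟨ht, trivial⟩

theorem ncard_terms {m n : ℕ} (V : Fin n → Set (Fin m → ℤ)) (r : ℕ) :
    {t : (Fin m → ℤ) × Fin n | t.1 ∈ V t.2 ∧ ordTot t.1 ≤ r}.ncard = ∑ j, cnt (V j) r := by
  classical
  have hfin : {t : (Fin m → ℤ) × Fin n | t.1 ∈ V t.2 ∧ ordTot t.1 ≤ r}.Finite :=
    (terms_finite m n r).subset fun v hv => hv.2
  rw [Set.ncard_eq_toFinset_card _ hfin,
    Finset.card_eq_sum_card_fiberwise (f := fun v => v.2) (t := Finset.univ) (by simp)]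
  refine Finset.sum_congr rfl fun j _ => ?_
  unfold cnt
  rw [← Set.ncard_coe_finset, ← Set.ncard_image_of_injective {v | v ∈ V j ∧ ordTot v ≤ r}
    (Prod.mk_left_injective j)]
  refine congrArg Set.ncard ?_
  ext ⟨v, k⟩
  simp only [Finset.coe_filter, Set.Finite.mem_toFinset, Set.mem_ofPred_eq, Set.mem_image,
    Prod.mk.injEq]
  constructor
  · rintro ⟨h, rfl⟩
    exact ⟨v, h, rfl, rfl⟩
  · rintro ⟨w, h, rfl, rfl⟩
    exact ⟨h, rfl⟩

theorem trdegGen_ge {L : Type*} [Field L] {K : Subfield L} {ι : Type*} (x : ι → L) (T A : Set ι)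
    (hT : T.Finite) (hA : A ⊆ T) (hi : AlgebraicIndepOn K x A) :
    A.ncard ≤ trdegGen K (x '' T) := by
  classical
  have hinj : Set.InjOn x A := by
    intro a ha b hb hab
    have := hi.injective (a₁ := ⟨a, ha⟩) (a₂ := ⟨b, hb⟩) hab
    exact congrArg Subtype.val this
  have hAf : (x '' A).Finite := (hT.subset hA).image x
  have hSf : (x '' T).Finite := hT.image x
  have hBind : AlgebraicIndependent K (fun y : (x '' A : Set L) => (y : L)) := hi.image
  rw [← hinj.ncard_image]
  unfold trdegGen
  refine le_csSup ⟨(x '' T).ncard, ?_⟩ ⟨hAf.toFinset, ?_, ?_, ?_⟩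
  · rintro d ⟨F, hF, rfl, _⟩
    rw [← Set.ncard_coe_finset]
    exact Set.ncard_le_ncard hF hSf
  · simp only [Set.Finite.coe_toFinset]
    exact Set.image_mono hA
  · exact (Set.ncard_eq_toFinset_card _ hAf).symm
  · have := hBind.comp
      (fun y : hAf.toFinset => (⟨y.1, hAf.mem_toFinset.1 y.2⟩ : (x '' A : Set L))) (by
        intro a b hab
        simp only [Subtype.mk.injEq] at hab
        exact Subtype.ext hab)
    exact this

theorem binomShift_eval (i r : ℕ) :
    (binomShift (i : ℕ) i).eval (r : ℚ) = ((r + i).choose i : ℚ) := by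
  unfold binomShift
  rw [Polynomial.eval_smul, Polynomial.eval_comp]
  have : Polynomial.eval (r : ℚ) (Polynomial.X + Polynomial.C (((i : ℕ) : ℤ) : ℚ)) =
      ((r + i : ℕ) : ℚ) := by simp
  rw [this, descPochhammer_eval_eq_descFactorial, Nat.descFactorial_eq_factorial_mul_choose]
  have : (i.factorial : ℚ) ≠ 0 := by exact_mod_cast i.factorial_ne_zero
  push_cast
  rw [smul_eq_mul, ← mul_assoc, inv_mul_cancel₀ this, one_mul]

theorem binomShift_natDegree (c : ℤ) (i : ℕ) : (binomShift c i).natDegree ≤ i := by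
  unfold binomShift
  refine (Polynomial.natDegree_smul_le _ _).trans ?_
  rw [Polynomial.natDegree_comp, Polynomial.natDegree_X_add_C, mul_one, descPochhammer_natDegree]

theorem orth_nonempty {m : ℕ} (s : Fin m → Bool) : (0 : Fin m → ℤ) ∈ orth s := by
  intro i
  simp

theorem lead_univ (m : ℕ) : lead (Set.univ : Set (Fin m → ℤ)) = 2 ^ m := by
  simp [lead]

theorem orth_indep {L : Type*} [Field L] (K : Subfield L) {m n : ℕ}
    (α : Fin m → RingAut L) (hc : ∀ i j, Commute (α i) (α j))
    (hK : ∀ i, K.map ↑(α i) = K) (η : Fin n → L) (G : Set ((Fin m → ℤ) × Fin n))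
    (hG : AlgebraicIndepOn K (fun t : (Fin m → ℤ) × Fin n => gammaPow α hc t.1 (η t.2)) G)
    (s : Fin m → Bool) (J : Finset (Fin n)) (hJ : ∀ j ∈ J, ∀ v ∈ orth s, (v, j) ∈ G) :
    AlgebraicIndepOn K (fun t : (Fin m → ℤ) × Fin n => gammaPow α hc t.1 (η t.2))
      {t | t.2 ∈ J} := by
  classical
  refine algebraicIndependent_of_finite_type fun F hF => ?_
  let N : ℕ := ∑ t ∈ hF.toFinset, ordTot t.1.1
  have hN : ∀ t ∈ F, ∀ i, (t.1.1 i).natAbs ≤ N := by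
    intro t ht i
    refine (Finset.single_le_sum (f := fun i => (t.1.1 i).natAbs) (fun _ _ => Nat.zero_le _)
      (Finset.mem_univ i)).trans ?_
    exact Finset.single_le_sum (f := fun t : {t : (Fin m → ℤ) × Fin n | t.2 ∈ J} => ordTot t.1.1)
      (fun _ _ => Nat.zero_le _) (hF.mem_toFinset.2 ht)
  let τ : Fin m → ℤ := fun i => if s i = true then (N : ℤ) else -(N : ℤ)
  have hmem : ∀ t ∈ F, (τ + t.1.1, t.1.2) ∈ G := by
    intro t ht
    refine hJ _ t.2 _ fun i => ?_
    have := hN t ht i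
    show if s i = true then 0 ≤ τ i + t.1.1 i else τ i + t.1.1 i ≤ 0
    simp only [τ]
    split_ifs <;> omega
  have h1 := hG.comp (fun t : F => (⟨(τ + t.1.1.1, t.1.1.2), hmem t.1 t.2⟩ : G)) (by
    intro a b hab
    simp only [Subtype.mk.injEq, Prod.mk.injEq, add_right_inj] at hab
    exact Subtype.ext (Subtype.ext (Prod.ext hab.1 hab.2)))
  let g : L →+* L := ((gammaPow α hc τ : L ≃+* L) : L →+* L)
  have hg : ∀ x ∈ K, g x ∈ K := fun x hx => (gammaPow_mem K α hc hK τ x).2 hx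
  refine AlgebraicIndependent.of_ringHom_of_comp_eq (S := K) (g.restrict K K hg) g ?_
    (RingHom.injective _) ?_
  · convert h1 using 1
    funext t
    simp only [Function.comp]
    rw [gammaPow_add]
    rfl
  · ext x
    rfl

/-- **Univariate `σ*`-dimension polynomial of an inversive difference field extension.**
Let `K` be an inversive difference field of characteristic zero with basic set
`σ = {α₁,…,α_m}` (pairwise commuting automorphisms of `L` with `α_i(K) = K`) and let
`L = K⟨η₁,…,η_n⟩*`.  Then there is a polynomial `φ_{η|K} ∈ ℚ[t]` with
(i) `φ_{η|K}(r) = trdeg_K K({γη_j : ord γ ≤ r})` for all sufficiently large `r`, and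
(ii) `deg φ_{η|K} ≤ m`, `φ_{η|K} = Σ_{i=0}^m a_i C(t+i,i)` with `a_i ∈ ℤ` and `2^m ∣ a_m`. -/
theorem exists_univariate_dimension_polynomial
    {L : Type*} [Field L] [CharZero L] (K : Subfield L) {m n : ℕ}
    (α : Fin m → RingAut L) (hc : ∀ i j, Commute (α i) (α j))
    (hK : ∀ i, K.map ↑(α i) = K) (η : Fin n → L)
    (hgen : Subfield.closure
      (↑K ∪ {x | ∃ (γ : Fin m → ℤ) (j : Fin n), x = gammaPow α hc γ (η j)}) = ⊤) :
    ∃ (φ : Polynomial ℚ) (a : Fin (m + 1) → ℤ),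
      (∃ r₀ : ℕ, ∀ r : ℕ, r₀ ≤ r →
        φ.eval (r : ℚ) = (trdegGen K {x | ∃ γ : Fin m → ℤ, ordTot γ ≤ r ∧
          ∃ j : Fin n, x = gammaPow α hc γ (η j)} : ℚ)) ∧
      φ.natDegree ≤ m ∧
      φ = ∑ i : Fin (m + 1), (a i : ℚ) • binomShift (i : ℕ) (i : ℕ) ∧
      (2 : ℤ) ^ m ∣ a (Fin.last m) := by
  classical
  set x : (Fin m → ℤ) × Fin n → L := fun t => gammaPow α hc t.1 (η t.2) with hx
  set G := greedy K key x with hGdef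
  have hG : AlgebraicIndepOn K x G := greedy_indep key key_inj x
  let W : Fin n → Set (Fin m → ℤ) := fun j => {v | (v, j) ∈ G}
  have hW : ∀ j, DownC (W j) := by
    intro j u v huv hv
    by_contra hu
    have hu' : IsAlgebraic (Algebra.adjoin K (x '' {t | key t < key (u, j)})) (x (u, j)) := by
      by_contra hn
      exact hu hn
    refine hv ?_
    have h1 := alg_map (gammaPow α hc (v - u))
      (fun y hy => (gammaPow_mem K α hc hK (v - u) y).2 hy) hu'
    have h2 : gammaPow α hc (v - u) (x (u, j)) = x (v, j) := by
      simp only [hx]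
      rw [← RingAut.mul_apply, ← gammaPow_add, sub_add_cancel]
    rw [h2] at h1
    refine alg_mono ?_ h1
    rintro _ ⟨_, ⟨⟨w, l⟩, hw, rfl⟩, rfl⟩
    refine ⟨(w + (v - u), l), key_shift huv hw, ?_⟩
    simp only [hx]
    rw [← RingAut.mul_apply, ← gammaPow_add, add_comm]
  have hS : ∀ r : ℕ, {y | ∃ γ : Fin m → ℤ, ordTot γ ≤ r ∧ ∃ j : Fin n,
      y = gammaPow α hc γ (η j)} = x '' {t | ordTot t.1 ≤ r} := by
    intro r
    ext y
    constructor
    · rintro ⟨γ, h, j, rfl⟩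
      exact ⟨(γ, j), h, rfl⟩
    · rintro ⟨⟨γ, j⟩, h, rfl⟩
      exact ⟨γ, h, j, rfl⟩
  have htr : ∀ r : ℕ, trdegGen K (x '' {t | ordTot t.1 ≤ r}) = ∑ j, cnt (W j) r := by
    intro r
    rw [trdegGen_eq key key_inj x _ (terms_finite m n r)
      (fun t ht u hu => (key_ord hu).trans ht), ← ncard_terms]
    rfl
  have hNP : NP m (∑ j, (lead (W j) : ℤ)) (fun r => ∑ j, (cnt (W j) r : ℤ)) :=
    NP.sum _ _ _ fun j _ => cnt_NP (W j) (hW j)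
  -- maximal independent set of indices
  obtain ⟨J, hJ, hJmax⟩ := (Finset.univ.filter fun J : Finset (Fin n) =>
    AlgebraicIndepOn K x {t | t.2 ∈ J}).exists_max_image Finset.card ⟨∅, by
      rw [Finset.mem_filter]
      refine ⟨Finset.mem_univ _, ?_⟩
      have : IsEmpty {t : (Fin m → ℤ) × Fin n | t.2 ∈ (∅ : Finset (Fin n))} :=
        ⟨fun t => by simpa using t.2⟩
      exact algebraicIndependent_empty_type⟩
  have hJ' := (Finset.mem_filter.1 hJ).2
  have hupper : ∑ j, lead (W j) ≤ 2 ^ m * J.card := by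
    unfold lead
    simp only [Finset.card_filter]
    rw [Finset.sum_comm]
    refine (Finset.sum_le_card_nsmul _ _ J.card fun s _ => ?_).trans (by simp)
    rw [← Finset.card_filter]
    refine hJmax _ (Finset.mem_filter.2 ⟨Finset.mem_univ _, ?_⟩)
    refine orth_indep K α hc hK η G hG s _ fun j hj v hv => ?_
    exact (Finset.mem_filter.1 hj).2 hv
  let V : Fin n → Set (Fin m → ℤ) := fun j => {_v | j ∈ J}
  have hVNP : NP m (∑ j, (lead (V j) : ℤ)) (fun r => ∑ j, (cnt (V j) r : ℤ)) :=
    NP.sum _ _ _ fun j _ => cnt_NP (V j) (fun _ _ _ h => h)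
  have hVlead : 2 ^ m * J.card ≤ ∑ j, lead (V j) := by
    calc 2 ^ m * J.card = ∑ j ∈ J, lead (V j) := by
          rw [Finset.sum_congr rfl (g := fun _ => 2 ^ m)]
          · simp [mul_comm]
          · intro j hj
            have : V j = Set.univ := by ext; simp [V, hj]
            rw [this, lead_univ]
      _ ≤ ∑ j, lead (V j) :=
          Finset.sum_le_sum_of_subset_of_nonneg (Finset.subset_univ _) fun _ _ _ => Nat.zero_le _
  have hcmp : ∑ j, (lead (V j) : ℤ) ≤ ∑ j, (lead (W j) : ℤ) := by
    refine hVNP.le hNP fun r => ?_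
    have h1 := trdegGen_ge (K := K) x {t | ordTot t.1 ≤ r}
      {t | t.1 ∈ V t.2 ∧ ordTot t.1 ≤ r} (terms_finite m n r) (fun t ht => ht.2)
      (hJ'.mono fun t ht => ht.1)
    rw [htr, ncard_terms] at h1
    exact_mod_cast h1
  have hlead : ∑ j, (lead (W j) : ℤ) = 2 ^ m * J.card := by
    have h1 : ∑ j, lead (V j) ≤ ∑ j, lead (W j) := by exact_mod_cast hcmp
    have h2 : ∑ j, lead (W j) = 2 ^ m * J.card := le_antisymm hupper (hVlead.trans h1)
    exact_mod_cast h2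
  obtain ⟨c, hcm, r₀, hr⟩ := hNP.binom
  refine ⟨∑ i : Fin (m + 1), (c i : ℚ) • binomShift (i : ℕ) (i : ℕ), fun i => c i,
    ⟨r₀, fun r hr' => ?_⟩, ?_, rfl, ?_⟩
  · rw [hS, htr, Polynomial.eval_finsetSum]
    have h1 := hr r hr'
    rw [← Fin.sum_univ_eq_sum_range (fun i => c i * ((r + i).choose i : ℤ))] at h1
    have h2 : ((∑ j, (cnt (W j) r : ℤ) : ℤ) : ℚ) =
      ((∑ i : Fin (m + 1), c i * ((r + i).choose i : ℤ) : ℤ) : ℚ) := by rw [h1]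
    push_cast at h2 ⊢
    rw [h2]
    refine Finset.sum_congr rfl fun i _ => ?_
    rw [Polynomial.eval_smul, binomShift_eval, smul_eq_mul]
  · refine Polynomial.natDegree_sum_le_of_forall_le _ _ fun i _ => ?_
    refine (Polynomial.natDegree_smul_le _ _).trans ((binomShift_natDegree _ _).trans ?_)
    omega
  · show (2 : ℤ) ^ m ∣ c ((Fin.last m : Fin (m + 1)) : ℕ)
    rw [Fin.val_last, hcm, hlead]
    exact dvd_mul_right _ _
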